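/- Let d ≥ 1. Every graph G on n vertices with more than (2^d − 1)·n − 2^{d−1} edges contains a nonempty 2^d-divisible subgraph, i.e., a nonempty subset E' of its edges such that for every vertex v, the number of edges of E' incident to v is divisible by 2^d. -/

import Mathlib

theorem Finset.sum_pow_eq_zero_of_pow_succ_eq_zero {ι R : Type*} [CommSemiring R]
    (s : Finset ι) (a : ι → R) (n : ι → ℕ) (h : ∀ i ∈ s, a i ^ (n i + 1) = 0) :
    (∑ i ∈ s, a i) ^ (∑ i ∈ s, n i + 1) = 0 := by
  classical
  induction s using Finset.induction_on with
  | empty => simp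
  | insert i s hi ih =>
    rw [Finset.sum_insert hi, Finset.sum_insert hi]
    exact (Commute.all _ _).add_pow_eq_zero_of_add_le_succ_of_pow_eq_zero
      (h i (Finset.mem_insert_self i s))
      (ih fun j hj => h j (Finset.mem_insert_of_mem hj)) (by omega)

/-- A product of more than `∑ n i` elements of the ideal generated by the `a i` vanishes when
`a i ^ (n i + 1) = 0` for all `i`. -/
theorem Ideal.prod_eq_zero_of_mem_sum_span {ι κ R : Type*} [CommRing R] [Fintype ι]
    (a : ι → R) (n : ι → ℕ) (h : ∀ i, a i ^ (n i + 1) = 0) (t : Finset κ) (f : κ → R)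
    (hf : ∀ k ∈ t, f k ∈ ∑ i, Ideal.span {a i}) (ht : ∑ i, n i < t.card) :
    ∏ k ∈ t, f k = 0 := by
  have h0 : (∑ i, Ideal.span {a i}) ^ (∑ i, n i + 1) = 0 :=
    Finset.sum_pow_eq_zero_of_pow_succ_eq_zero _ _ _ fun i _ => by
      rw [Ideal.span_singleton_pow, h, Ideal.span_singleton_zero, Ideal.zero_eq_bot]
  have hmem := Ideal.prod_mem_prod hf
  rw [Finset.prod_const] at hmem
  have hle := Ideal.pow_le_pow_right ht hmem
  rwa [Nat.succ_eq_add_one, h0] at hle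

/-- In characteristic two, if `x v ^ 2 ^ (d + 1) = 1` for all `v`, then sufficiently many factors
of the form `x u * x v - 1` multiply to zero. -/
theorem prod_sym2_mul_sub_one_eq_zero {V R : Type*} [CommRing R] [CharP R 2] [Fintype V] (d : ℕ)
    (x : V → R) (hx : ∀ v, x v ^ 2 ^ (d + 1) = 1) (t : Finset (Sym2 V))
    (ht : (2 ^ (d + 1) - 1) * Fintype.card V - 2 ^ d < t.card) :
    ∏ e ∈ t, ((e.map x).mul - 1) = 0 := by
  classical
  obtain ⟨e, -⟩ := Finset.card_pos.mp (by omega : 0 < t.card)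
  let r : V := e.out.1
  have hsum : ∑ v, (if v = r then 2 ^ d - 1 else 2 ^ (d + 1) - 1) < t.card := by
    have hpos : 0 < Fintype.card V := Fintype.card_pos_iff.mpr ⟨r⟩
    rw [← Finset.add_sum_erase _ _ (Finset.mem_univ r), if_pos rfl,
      Finset.sum_congr rfl fun v hv => if_neg (Finset.ne_of_mem_erase hv), Finset.sum_const,
      Finset.card_erase_of_mem (Finset.mem_univ r), Finset.card_univ, smul_eq_mul]
    obtain ⟨m, hm⟩ : ∃ m, Fintype.card V = m + 1 := ⟨_, (Nat.succ_pred_eq_of_pos hpos).symm⟩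
    have hd : 0 < 2 ^ d := by positivity
    rw [hm, mul_add, mul_one, mul_comm] at ht
    rw [hm, Nat.add_sub_cancel]
    rw [pow_succ] at *
    omega
  refine Ideal.prod_eq_zero_of_mem_sum_span (fun v => x v * x r - 1) _ (fun v => ?_) t _
    (fun e _ => ?_) hsum
  · split_ifs with hv
    · rw [Nat.sub_add_cancel Nat.one_le_two_pow, sub_pow_char_pow, one_pow, hv, ← sq, ← pow_mul,
        ← pow_succ', hx, sub_self]
    · rw [Nat.sub_add_cancel Nat.one_le_two_pow, sub_pow_char_pow, one_pow, mul_pow, hx, hx,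
        mul_one, sub_self]
  · have hmem (v : V) : x v * x r - 1 ∈ ∑ i, Ideal.span {x i * x r - 1} :=
      Finset.single_le_sum_of_canonicallyOrdered (f := fun i => Ideal.span {x i * x r - 1})
        (Finset.mem_univ v) (Ideal.mem_span_singleton_self _)
    induction e using Sym2.ind with
    | _ u v =>
      have key : x u * x v - 1 = x v * x r * (x u * x r - 1) + (x v * x r - 1)
          - x u * x v * (x r * x r - 1) := by ring
      rw [Sym2.map_mk, Sym2.mul_mk]
      change x u * x v - 1 ∈ _
      rw [key]
      exact sub_mem (add_mem (Ideal.mul_mem_left _ _ (hmem u)) (hmem v))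
        (Ideal.mul_mem_left _ _ (hmem r))

/-- **`2^d`-divisible subgraphs.** Every graph on `n` vertices with more than
`(2 ^ d − 1) · n − 2 ^ (d−1)` edges contains a nonempty `2 ^ d`-divisible
subgraph: a nonempty set `E'` of edges such that every vertex is incident to a
number of edges of `E'` divisible by `2 ^ d`. -/
theorem two_power_divisible_subgraph
    (d : ℕ) (hd : 1 ≤ d)
    {V : Type*} [Fintype V] [DecidableEq V]
    (G : SimpleGraph V) [DecidableRel G.Adj]
    (hm : (2 ^ d - 1) * Fintype.card V - 2 ^ (d - 1) < G.edgeFinset.card) :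
    ∃ E' ⊆ G.edgeFinset, E'.Nonempty ∧
      ∀ v : V, 2 ^ d ∣ (E'.filter fun e => v ∈ e).card := by
  obtain ⟨d, rfl⟩ : ∃ k, d = k + 1 := ⟨d - 1, by omega⟩
  rw [Nat.add_sub_cancel] at hm
  by_contra! hno
  let A := AddMonoidAlgebra (ZMod 2) (V → ZMod (2 ^ (d + 1)))
  have : CharP A 2 := charP_of_injective_algebraMap
    (FaithfulSMul.algebraMap_injective (ZMod 2) A) 2
  let x : V → A := fun v => AddMonoidAlgebra.single (Pi.single v 1) 1
  have hx (v : V) : x v ^ 2 ^ (d + 1) = 1 := by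
    rw [AddMonoidAlgebra.single_pow, one_pow, ← Pi.single_smul, nsmul_one, ZMod.natCast_self,
      Pi.single_zero, AddMonoidAlgebra.one_def]
  have hzero := prod_sym2_mul_sub_one_eq_zero d x hx G.edgeFinset hm
  have hedge : ∀ e ∈ G.edgeFinset, (e.map x).mul =
      AddMonoidAlgebra.single (fun v => if v ∈ e then 1 else 0) 1 := by
    intro e he
    induction e using Sym2.ind with
    | _ u v =>
      have huv : u ≠ v := (SimpleGraph.mem_edgeFinset.mp he).ne
      rw [Sym2.map_mk, Sym2.mul_mk]
      change x u * x v = _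
      rw [AddMonoidAlgebra.single_mul_single, one_mul]
      congr 1
      ext w
      by_cases h1 : w = u <;> by_cases h2 : w = v <;> simp_all
  have hprod (S : Finset (Sym2 V)) (hS : S ⊆ G.edgeFinset) : ∏ e ∈ S, (e.map x).mul =
      AddMonoidAlgebra.single (fun v => ((S.filter fun e => v ∈ e).card : ZMod (2 ^ (d + 1)))) 1 := by
    rw [Finset.prod_congr rfl fun e he => hedge e (hS he)]
    clear hS
    induction S using Finset.induction_on with
    | empty =>
      simp only [Finset.prod_empty, Finset.filter_empty, Finset.card_empty, Nat.cast_zero]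
      rfl
    | insert e S he ih =>
      rw [Finset.prod_insert he, ih, AddMonoidAlgebra.single_mul_single, one_mul]
      congr 1
      ext v
      rw [Pi.add_apply, Finset.filter_insert]
      split_ifs with hv
      · rw [Finset.card_insert_of_notMem (by simp [he]), Nat.cast_succ]
        exact add_comm _ _
      · rw [zero_add]
  simp_rw [CharTwo.sub_eq_add] at hzero
  rw [Finset.prod_add_one, Finset.sum_congr rfl fun S hS => hprod S (Finset.mem_powerset.mp hS)]
    at hzero
  have hcoeff : (∑ S ∈ G.edgeFinset.powerset, AddMonoidAlgebra.single
      (fun v => ((S.filter fun e => v ∈ e).card : ZMod (2 ^ (d + 1)))) (1 : ZMod 2)).coeff 0 = 0 :=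
    congrArg (fun a : A => a.coeff 0) hzero
  simp only [AddMonoidAlgebra.coeff_sum, Finsupp.finsetSum_apply] at hcoeff
  rw [Finset.sum_eq_single_of_mem ∅ (Finset.empty_mem_powerset _)] at hcoeff
  · simp [← Pi.zero_def] at hcoeff
  · intro S hS hne
    obtain ⟨v, hv⟩ := hno S (Finset.mem_powerset.mp hS) (Finset.nonempty_iff_ne_empty.mpr hne)
    rw [AddMonoidAlgebra.coeff_single, Finsupp.single_eq_of_ne']
    intro h
    exact hv ((ZMod.natCast_eq_zero_iff _ _).mp (congrFun h v))
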